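/- arXiv:1712.01330 — 2 statements merged into one kernel-verified Lean document; each statement's English description precedes it below -/
import Mathlib

section
/- Let n ≥ 1 and 1 ≤ r ≤ 2n be integers, let A be a uniformly random r-element subset of the 2n-element set [n] × {0,1}, and let Y = |{j ∈ [n] : (j,0) ∈ A and (j,1) ∈ A}|. If t ≥ 1 is an integer and r ≤ (2/e)·√(n·t), then Pr[Y ≥ t] ≤ e^{−t}. -/
/-- The number of complete pairs `{(j,0),(j,1)}` contained in a subset `A` of `[n] × {0,1}`. -/
def pairCount (n : ℕ) (A : Finset (Fin n × Bool)) : ℕ :=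
  (Finset.univ.filter (fun j : Fin n => (j, false) ∈ A ∧ (j, true) ∈ A)).card

theorem desc_aux (m r k : ℕ) (h : r ≤ m) :
    m ^ k * r.descFactorial k ≤ r ^ k * m.descFactorial k := by
  induction k with
  | zero => simp
  | succ k ih =>
    rw [Nat.descFactorial_succ, Nat.descFactorial_succ, pow_succ, pow_succ]
    have h1 : m * (r - k) ≤ r * (m - k) := by
      rw [Nat.mul_sub, Nat.mul_sub, mul_comm m r]
      have := Nat.mul_le_mul_right k h
      omega
    calc m ^ k * m * ((r - k) * r.descFactorial k)
        = (m ^ k * r.descFactorial k) * (m * (r - k)) := by ring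
      _ ≤ (r ^ k * m.descFactorial k) * (r * (m - k)) := Nat.mul_le_mul ih h1
      _ = _ := by ring

theorem choose_aux (m r k : ℕ) (h : r ≤ m) :
    m ^ k * r.choose k ≤ r ^ k * m.choose k := by
  have h1 := desc_aux m r k h
  rw [Nat.descFactorial_eq_factorial_mul_choose, Nat.descFactorial_eq_factorial_mul_choose] at h1
  refine Nat.le_of_mul_le_mul_left ?_ (Nat.factorial_pos k)
  calc _ = m ^ k * (k.factorial * r.choose k) := by ring
    _ ≤ _ := h1
    _ = _ := by ring

theorem count_aux {α : Type*} [Fintype α] [DecidableEq α] (P : Finset α) (r : ℕ)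
    (h : P.card ≤ r) :
    (((Finset.univ : Finset α).powersetCard r).filter (fun A => P ⊆ A)).card ≤
      (Fintype.card α - P.card).choose (r - P.card) := by
  rw [← Finset.card_compl, ← Finset.card_powersetCard]
  refine Finset.card_le_card_of_injOn (fun A => A \ P) ?_ ?_
  · intro A hA
    simp only [Finset.coe_filter, Finset.mem_powersetCard, Set.mem_ofPred_eq] at hA
    simp only [Finset.mem_coe, Finset.mem_powersetCard]
    refine ⟨?_, ?_⟩
    · intro x hx
      simp at hx ⊢
      exact hx.2
    · rw [Finset.card_sdiff_of_subset hA.2, hA.1.2]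
  · intro A hA B hB hAB
    simp only [Finset.coe_filter, Finset.mem_powersetCard, Set.mem_ofPred_eq] at hA hB
    simp only at hAB
    rw [← Finset.sdiff_union_of_subset hA.2, hAB, Finset.sdiff_union_of_subset hB.2]

theorem exists_aux (n t : ℕ) (A : Finset (Fin n × Bool)) (h : t ≤ pairCount n A) :
    ∃ S ∈ (Finset.univ : Finset (Fin n)).powersetCard t, S ×ˢ (Finset.univ : Finset Bool) ⊆ A := by
  obtain ⟨S, hS, hc⟩ := Finset.exists_subset_card_eq h
  refine ⟨S, by simp [hc], ?_⟩
  rintro ⟨j, b⟩ hx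
  have hj : j ∈ S := by simpa using hx
  have := hS hj
  simp at this
  cases b
  · exact this.1
  · exact this.2

theorem union_aux (n r t : ℕ) (h : 2 * t ≤ r) :
    (((Finset.univ : Finset (Fin n × Bool)).powersetCard r).filter
          (fun A => t ≤ pairCount n A)).card ≤ n.choose t * (2 * n - 2 * t).choose (r - 2 * t) := by
  have hsub : (((Finset.univ : Finset (Fin n × Bool)).powersetCard r).filter
          (fun A => t ≤ pairCount n A)) ⊆
      ((Finset.univ : Finset (Fin n)).powersetCard t).biUnion (fun S =>
        ((Finset.univ : Finset (Fin n × Bool)).powersetCard r).filter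
          (fun A => S ×ˢ (Finset.univ : Finset Bool) ⊆ A)) := by
    intro A hA
    rw [Finset.mem_filter] at hA
    obtain ⟨S, hS, hSA⟩ := exists_aux n t A hA.2
    exact Finset.mem_biUnion.2 ⟨S, hS, Finset.mem_filter.2 ⟨hA.1, hSA⟩⟩
  refine (Finset.card_le_card hsub).trans ((Finset.card_biUnion_le_card_mul _ _
    ((2 * n - 2 * t).choose (r - 2 * t)) ?_).trans ?_)
  · intro S hS
    have hc : (S ×ˢ (Finset.univ : Finset Bool)).card = 2 * t := by
      rw [Finset.card_product, (Finset.mem_powersetCard.1 hS).2]; simp [mul_comm]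
    have := count_aux (S ×ˢ (Finset.univ : Finset Bool)) r (by omega)
    rw [hc] at this
    simpa [mul_comm] using this
  · simp

theorem empty_aux (n r t : ℕ) (h : r < 2 * t) :
    (((Finset.univ : Finset (Fin n × Bool)).powersetCard r).filter
          (fun A => t ≤ pairCount n A)).card = 0 := by
  rw [Finset.card_eq_zero, Finset.filter_eq_empty_iff]
  intro A hA ht
  obtain ⟨S, hS, hSA⟩ := exists_aux n t A ht
  have h1 := Finset.card_le_card hSA
  rw [Finset.card_product, (Finset.mem_powersetCard.1 hS).2, (Finset.mem_powersetCard.1 hA).2] at h1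
  simp at h1
  omega

/-- For a uniformly random `r`-element subset `A` of `[n] × {0,1}`, and `Y` the number of
complete pairs in `A`, if `t ≥ 1` and `r ≤ (2/e)·√(n·t)`, then `Pr[Y ≥ t] ≤ e^{−t}`. -/
theorem stmt_1 (n r t : ℕ) (hn : 1 ≤ n) (hr1 : 1 ≤ r) (hr2 : r ≤ 2 * n) (ht : 1 ≤ t)
    (hr3 : (r : ℝ) ≤ 2 / Real.exp 1 * Real.sqrt (n * t)) :
    ((((Finset.univ : Finset (Fin n × Bool)).powersetCard r).filter
          (fun A => t ≤ pairCount n A)).card : ℝ) /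
        (((Finset.univ : Finset (Fin n × Bool)).powersetCard r).card : ℝ) ≤
      Real.exp (-(t : ℝ)) := by
  by_cases h2 : r < 2 * t
  · rw [empty_aux n r t h2]
    simp [Real.exp_nonneg]
  push Not at h2
  have hU := union_aux n r t h2
  have hcard : ((Finset.univ : Finset (Fin n × Bool)).powersetCard r).card = (2 * n).choose r := by
    simp [mul_comm]
  rw [hcard]
  have hCpos : (0 : ℝ) < ((2 * n).choose r : ℝ) := by
    exact_mod_cast Nat.choose_pos hr2
  have hKpos : (0 : ℝ) < ((2 * n).choose (2 * t) : ℝ) := by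
    exact_mod_cast Nat.choose_pos (h2.trans hr2)
  have hnpos : (0 : ℝ) < n := by exact_mod_cast hn
  have hmul : ((2 * n).choose r : ℝ) * (r.choose (2 * t) : ℝ)
      = ((2 * n).choose (2 * t) : ℝ) * ((2 * n - 2 * t).choose (r - 2 * t) : ℝ) := by
    exact_mod_cast Nat.choose_mul (n := 2 * n) h2
  have hch : (2 * (n : ℝ)) ^ (2 * t) * (r.choose (2 * t) : ℝ)
      ≤ (r : ℝ) ^ (2 * t) * ((2 * n).choose (2 * t) : ℝ) := by
    exact_mod_cast choose_aux (2 * n) r (2 * t) hr2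
  have hUR : ((((Finset.univ : Finset (Fin n × Bool)).powersetCard r).filter
          (fun A => t ≤ pairCount n A)).card : ℝ) ≤
      (n.choose t : ℝ) * ((2 * n - 2 * t).choose (r - 2 * t) : ℝ) := by exact_mod_cast hU
  have hratio : ((2 * n - 2 * t).choose (r - 2 * t) : ℝ) / ((2 * n).choose r : ℝ)
      ≤ ((r : ℝ) ^ 2 / (2 * n) ^ 2) ^ t := by
    rw [div_pow, ← pow_mul, ← pow_mul, div_le_div_iff₀ hCpos (by positivity)]
    refine le_of_mul_le_mul_left ?_ hKpos
    have := mul_le_mul_of_nonneg_left hch hCpos.le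
    calc _ = (((2 * n).choose (2 * t) : ℝ) * ((2 * n - 2 * t).choose (r - 2 * t) : ℝ))
            * (2 * (n : ℝ)) ^ (2 * t) := by ring
      _ = ((2 * n).choose r : ℝ) * ((2 * (n : ℝ)) ^ (2 * t) * (r.choose (2 * t) : ℝ)) := by
          rw [← hmul]; ring
      _ ≤ _ := this
      _ = _ := by ring
  have hsq : (r : ℝ) ^ 2 / (2 * n) ^ 2 ≤ t / (n * Real.exp 1 ^ 2) := by
    have h3 : (r : ℝ) ^ 2 ≤ (2 / Real.exp 1 * Real.sqrt (n * t)) ^ 2 :=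
      pow_le_pow_left₀ (by positivity) hr3 2
    rw [mul_pow, Real.sq_sqrt (by positivity)] at h3
    calc _ ≤ ((2 / Real.exp 1) ^ 2 * (n * t)) / (2 * (n : ℝ)) ^ 2 := by gcongr
      _ = _ := by
        have := Real.exp_pos 1
        field_simp
  have hnt : (n.choose t : ℝ) ≤ (n : ℝ) ^ t / t.factorial := Nat.choose_le_pow_div t n
  have hfac : (t : ℝ) ^ t / t.factorial ≤ Real.exp t :=
    Real.pow_div_factorial_le_exp (t : ℝ) (by positivity) t
  have hE : Real.exp 1 ^ t = Real.exp t := by rw [← Real.exp_nat_mul, mul_one]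
  calc _ ≤ (n.choose t : ℝ) * ((2 * n - 2 * t).choose (r - 2 * t) : ℝ) / ((2 * n).choose r : ℝ) := by
        gcongr
    _ = (n.choose t : ℝ) * (((2 * n - 2 * t).choose (r - 2 * t) : ℝ) / ((2 * n).choose r : ℝ)) := by
        ring
    _ ≤ ((n : ℝ) ^ t / t.factorial) * (t / (n * Real.exp 1 ^ 2)) ^ t := by
        refine mul_le_mul hnt (hratio.trans ?_) (by positivity) (by positivity)
        gcongr
    _ = ((t : ℝ) ^ t / t.factorial) / (Real.exp t * Real.exp t) := by
        rw [div_pow, mul_pow, ← hE, ← pow_mul, mul_comm 2 t, pow_mul]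
        have := Real.exp_pos 1
        field_simp
    _ ≤ Real.exp t / (Real.exp t * Real.exp t) := by gcongr
    _ = Real.exp (-(t : ℝ)) := by
        rw [Real.exp_neg]
        have := Real.exp_pos t
        field_simp
end

section
/- There exists a constant c > 0 such that for every integer n ≥ 2, if x = (x_1, …, x_{2n}) is drawn uniformly at random from [n]^{2n} and U(x) denotes the number of unique pairs of x, then Pr[U(x) ≥ (n−1)/(4e²)] ≥ c. -/
/-- The set of unique pairs of `x ∈ [n]^{2n}`: pairs `(i, j)` with `i < j`, `x_i = x_j`, and
no other index `k` has `x_k = x_i`. -/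
def uniquePairs (n : ℕ) (x : Fin (2 * n) → Fin n) : Finset (Fin (2 * n) × Fin (2 * n)) :=
  Finset.univ.filter
    (fun p => p.1 < p.2 ∧ x p.1 = x p.2 ∧ ∀ k, k ≠ p.1 → k ≠ p.2 → x k ≠ x p.1)

theorem aux_pairs (m : ℕ) :
    ((Finset.univ : Finset (Fin m × Fin m)).filter (fun p => p.1 < p.2)).card * 2 = m * (m - 1) := by
  have h : ((Finset.univ : Finset (Fin m × Fin m)).filter (fun p => p.1 < p.2)).card
      = ∑ i ∈ Finset.range m, (m - 1 - i) := by
    rw [Finset.card_filter, Fintype.sum_prod_type, ← Fin.sum_univ_eq_sum_range (fun i => m - 1 - i)]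
    refine Finset.sum_congr rfl fun i _ => ?_
    rw [← Finset.card_filter, ← Fin.card_Ioi]
    congr 1
    ext j
    simp
  rw [h, Finset.sum_range_reflect (fun i => i), Finset.sum_range_id_mul_two]

theorem aux_count (n : ℕ) (i j : Fin (2 * n)) (hij : i < j) :
    ((Finset.univ : Finset (Fin (2 * n) → Fin n)).filter
      (fun x => x i = x j ∧ ∀ k, k ≠ i → k ≠ j → x k ≠ x i)).card = n * (n - 1) ^ (2 * n - 2) := by
  rw [Finset.card_eq_sum_card_fiberwise (f := fun x => x i) (t := Finset.univ) (by simp)]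
  have h : ∀ v : Fin n, (((Finset.univ : Finset (Fin (2 * n) → Fin n)).filter
      (fun x => x i = x j ∧ ∀ k, k ≠ i → k ≠ j → x k ≠ x i)).filter (fun x => x i = v)).card
      = (n - 1) ^ (2 * n - 2) := by
    intro v
    have h1 : (((Finset.univ : Finset (Fin (2 * n) → Fin n)).filter
      (fun x => x i = x j ∧ ∀ k, k ≠ i → k ≠ j → x k ≠ x i)).filter (fun x => x i = v))
      = Fintype.piFinset (fun k => if k ∈ ({i, j} : Finset (Fin (2 * n))) then {v} else {v}ᶜ) := by
      ext x
      simp only [Finset.mem_filter, Finset.mem_univ, true_and, Fintype.mem_piFinset,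
        Finset.mem_insert, Finset.mem_singleton]
      constructor
      · rintro ⟨⟨h1, h2⟩, h3⟩ k
        by_cases hk : k = i
        · simp [hk, h3]
        by_cases hk' : k = j
        · simp [hk', ← h1, h3]
        have := h2 k hk hk'
        simp [hk, hk', ← h3, this]
      · intro h
        have hi := h i
        have hj := h j
        simp at hi hj
        refine ⟨⟨by rw [hi, hj], fun k h1 h2 => ?_⟩, hi⟩
        have := h k
        simpa [h1, h2, hi] using this
    rw [h1, Fintype.card_piFinset]
    have h2 : ∀ k, (if k ∈ ({i, j} : Finset (Fin (2 * n))) then ({v} : Finset (Fin n)) else {v}ᶜ).card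
       = if k ∈ ({i, j} : Finset (Fin (2 * n))) then 1 else (n - 1) := by
      intro k
      split_ifs <;> simp [Finset.card_compl]
    rw [Finset.prod_congr rfl fun k _ => h2 k, Finset.prod_ite, Finset.prod_const_one, one_mul,
      Finset.prod_const]
    congr 1
    have : (Finset.univ.filter fun k => k ∉ ({i, j} : Finset (Fin (2 * n)))) = {i, j}ᶜ := by
      ext k; simp
    rw [this, Finset.card_compl, Finset.card_pair hij.ne, Fintype.card_fin]
  rw [Finset.sum_congr rfl fun v _ => h v]
  simp

theorem aux_sum (n : ℕ) :
    (∑ x : Fin (2 * n) → Fin n, (uniquePairs n x).card)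
      = n * (2 * n - 1) * (n * (n - 1) ^ (2 * n - 2)) := by
  have hp := aux_pairs (2 * n)
  have hp' : ((Finset.univ : Finset (Fin (2 * n) × Fin (2 * n))).filter (fun p => p.1 < p.2)).card
      = n * (2 * n - 1) := by
    rw [mul_assoc] at hp; omega
  rw [← hp', ← smul_eq_mul (Finset.card _), ← Finset.sum_const]
  simp only [uniquePairs, Finset.card_filter]
  rw [Finset.sum_comm, Finset.sum_filter]
  refine Finset.sum_congr rfl fun p _ => ?_
  split_ifs with h
  · rw [← aux_count n p.1 p.2 h, Finset.card_filter]
    simp [h]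
  · simp [h]

theorem aux_le (n : ℕ) (x : Fin (2 * n) → Fin n) : (uniquePairs n x).card ≤ n := by
  have := Finset.card_le_card_of_injOn (s := uniquePairs n x) (t := (Finset.univ : Finset (Fin n)))
    (fun p => x p.1) (by simp) (by
      rintro ⟨a, b⟩ h ⟨c, d⟩ h' he
      simp [uniquePairs] at h h' he
      obtain ⟨h1, h2, h3⟩ := h
      obtain ⟨h1', h2', h3'⟩ := h'
      have hc : c = a ∨ c = b := by
        by_contra! hh
        exact h3 c hh.1 hh.2 he.symm
      have hd : d = a ∨ d = b := by
        by_contra! hh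
        exact h3 d hh.1 hh.2 (by rw [← h2', he])
      ext <;> grind)
  simpa using this

theorem aux_exp (m : ℕ) (hm : 1 ≤ m) :
    ((m : ℝ) + 1) ^ (2 * m) ≤ Real.exp 1 ^ 2 * (m : ℝ) ^ (2 * m) := by
  have hm0 : (0 : ℝ) < m := by exact_mod_cast hm
  have h1 : (m : ℝ) + 1 ≤ m * Real.exp (1 / m) := by
    have := Real.add_one_le_exp (1 / (m : ℝ))
    calc (m : ℝ) + 1 = m * (1 / m + 1) := by field_simp; ring
      _ ≤ _ := by gcongr
  calc ((m : ℝ) + 1) ^ (2 * m) ≤ (m * Real.exp (1 / m)) ^ (2 * m) := by gcongr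
    _ = _ := by
      rw [mul_pow, ← Real.exp_nat_mul, ← Real.exp_nat_mul, mul_comm]
      congr 2
      push_cast
      field_simp

/-- There is a constant `c > 0` such that for every `n ≥ 2`, for `x` drawn uniformly from
`[n]^{2n}`, the number `U(x)` of unique pairs of `x` satisfies
`Pr[U(x) ≥ (n−1)/(4e²)] ≥ c`. -/
theorem stmt_10 :
    ∃ c : ℝ, 0 < c ∧ ∀ n : ℕ, 2 ≤ n →
      c ≤ (((Finset.univ : Finset (Fin (2 * n) → Fin n)).filter
            (fun x => ((n : ℝ) - 1) / (4 * Real.exp 1 ^ 2) ≤ ((uniquePairs n x).card : ℝ))).card : ℝ) /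
          (((Finset.univ : Finset (Fin (2 * n) → Fin n)).card : ℝ)) := by
  refine ⟨1 / Real.exp 1 ^ 2, by positivity, fun n hn => ?_⟩
  have hN : ((Finset.univ : Finset (Fin (2 * n) → Fin n)).card : ℝ) = (n : ℝ) ^ (2 * n) := by
    simp
  set N : ℝ := ((Finset.univ : Finset (Fin (2 * n) → Fin n)).card : ℝ) with hNdef
  set E : ℝ := Real.exp 1 ^ 2 with hE
  have hEpos : 0 < E := by positivity
  have hn0 : (2 : ℝ) ≤ n := by exact_mod_cast hn
  have hNpos : 0 < N := by rw [hN]; positivity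
  set t : ℝ := ((n : ℝ) - 1) / (4 * E) with ht
  have ht0 : 0 ≤ t := div_nonneg (by linarith) (by positivity)
  set G := (Finset.univ : Finset (Fin (2 * n) → Fin n)).filter
            (fun x => t ≤ ((uniquePairs n x).card : ℝ)) with hG
  have hup : (∑ x : Fin (2 * n) → Fin n, ((uniquePairs n x).card : ℝ)) ≤ n * G.card + t * N := by
    calc _ ≤ ∑ x : Fin (2 * n) → Fin n,
        ((if t ≤ ((uniquePairs n x).card : ℝ) then (n : ℝ) else 0) + t) := by
          refine Finset.sum_le_sum fun x _ => ?_
          have : ((uniquePairs n x).card : ℝ) ≤ n := by exact_mod_cast aux_le n x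
          split_ifs with h <;> linarith
      _ = _ := by
        rw [Finset.sum_add_distrib, ← Finset.sum_filter, Finset.sum_const, Finset.sum_const,
          nsmul_eq_mul, nsmul_eq_mul]
        ring
  have hlow : (2 * (n : ℝ) - 1) * N ≤ E * ∑ x : Fin (2 * n) → Fin n, ((uniquePairs n x).card : ℝ) := by
    have h := aux_sum n
    have h' : (∑ x : Fin (2 * n) → Fin n, ((uniquePairs n x).card : ℝ))
      = ((n * (2 * n - 1) * (n * (n - 1) ^ (2 * n - 2)) : ℕ) : ℝ) := by
      rw [← h]; push_cast; rfl
    rw [h', hN]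
    obtain ⟨m, rfl⟩ : ∃ m, n = m + 1 := ⟨n - 1, by omega⟩
    have he := aux_exp m (by omega)
    rw [← hE] at he
    have e1 : 2 * (m + 1) - 1 = 2 * m + 1 := by omega
    have e2 : 2 * (m + 1) - 2 = 2 * m := by omega
    rw [e1, e2, Nat.add_sub_cancel]
    push_cast
    calc (2 * ((m : ℝ) + 1) - 1) * ((m : ℝ) + 1) ^ (2 * (m + 1))
        = (2 * m + 1) * (m + 1) ^ 2 * ((m : ℝ) + 1) ^ (2 * m) := by ring
      _ ≤ (2 * m + 1) * (m + 1) ^ 2 * (E * (m : ℝ) ^ (2 * m)) := by gcongr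
      _ = _ := by ring
  rw [div_le_div_iff₀ hEpos hNpos, one_mul]
  have hEt : E * t = (n - 1) / 4 := by rw [ht]; field_simp
  have h3 : (2 * (n : ℝ) - 1) * N ≤ n * (G.card * E) + (n - 1) / 4 * N := by
    rw [← hEt]
    have := mul_le_mul_of_nonneg_left hup hEpos.le
    linarith
  have h4 : (n : ℝ) * N ≤ n * (G.card * E) := by nlinarith
  exact le_of_mul_le_mul_left h4 (by linarith)
end
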